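/- Let T be an ABC-tile having exactly 14 neighbors and let α be a neighbor of T. Then, in the subspace topology on the topological boundary ∂T of T, the closure of the interior of the set T ∩ (T + α) equals T ∩ (T + α); that is, T ∩ (T + α) is regular closed as a subset of the space ∂T. -/

import Mathlib

open MeasureTheory

noncomputable def Mmat (A B C : ℤ) : Matrix (Fin 3) (Fin 3) ℝ :=
  !![0, 0, -(C : ℝ); 1, 0, -(B : ℝ); 0, 1, -(A : ℝ)]

def Ddig (C : ℤ) : Set (Fin 3 → ℝ) :=
  {d | ∃ i : ℤ, 0 ≤ i ∧ i < C ∧ d = ![(i : ℝ), 0, 0]}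

def toR (α : Fin 3 → ℤ) : Fin 3 → ℝ := fun i => (α i : ℝ)

def tileTranslate (v : Fin 3 → ℝ) (T : Set (Fin 3 → ℝ)) : Set (Fin 3 → ℝ) :=
  (fun x => x + v) '' T

def IsABCTile (A B C : ℤ) (T : Set (Fin 3 → ℝ)) : Prop :=
  1 ≤ A ∧ A ≤ B ∧ B < C ∧
  T.Nonempty ∧ IsCompact T ∧ 0 < volume T ∧
  (Mmat A B C).mulVec '' T = ⋃ d ∈ Ddig C, tileTranslate d T

def Neighbors (T : Set (Fin 3 → ℝ)) : Set (Fin 3 → ℤ) :=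
  {α | α ≠ 0 ∧ (T ∩ tileTranslate (toR α) T).Nonempty}

/-- Inverse of the matrix `M`. -/
noncomputable def Gm (A B C : ℤ) (y : Fin 3 → ℝ) : Fin 3 → ℝ :=
  ![y 1 - B * (y 0 / C), y 2 - A * (y 0 / C), -(y 0 / C)]

/-- Lattice points in the basis P, Q, N. -/
def Jz (A B : ℤ) (v : ℤ × ℤ × ℤ) : Fin 3 → ℤ :=
  ![v.1 + A * v.2.1 + B * v.2.2, v.2.1 + A * v.2.2, v.2.2]

def Jr (A B : ℤ) (v : ℤ × ℤ × ℤ) : Fin 3 → ℝ := toR (Jz A B v)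

def dig (d : ℤ) : Fin 3 → ℝ := ![(d : ℝ), 0, 0]

noncomputable def gm (A B C d : ℤ) (x : Fin 3 → ℝ) : Fin 3 → ℝ := Gm A B C (x + dig d)

/-- The transition map on lattice codes. -/
def fm (A B C d : ℤ) (v : ℤ × ℤ × ℤ) : ℤ × ℤ × ℤ :=
  (v.2.1, v.2.2, -((v.1 + A * v.2.1 + B * v.2.2 + d) / C))

structure Ctx (A B C : ℤ) (T : Set (Fin 3 → ℝ)) : Prop where
  hA : 1 ≤ A
  hAB : A ≤ B
  hBC : B < C
  ne : T.Nonempty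
  cpt : IsCompact T
  sub : ∀ x ∈ T, ∀ d : ℤ, 0 ≤ d → d < C → gm A B C d x ∈ T
  sup : ∀ y ∈ T, ∃ d : ℤ, 0 ≤ d ∧ d < C ∧ ∃ x ∈ T, y = gm A B C d x

theorem mulVec_Mmat (A B C : ℤ) (y : Fin 3 → ℝ) :
    (Mmat A B C).mulVec y = ![-(C : ℝ) * y 2, y 0 - B * y 2, y 1 - A * y 2] := by
  ext i; fin_cases i <;> simp [Mmat, Matrix.mulVec, dotProduct, Fin.sum_univ_three] <;> ring

theorem Gm_mulVec (A B C : ℤ) (hC : 0 < C) (y : Fin 3 → ℝ) :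
    Gm A B C ((Mmat A B C).mulVec y) = y := by
  have hC' : (C : ℝ) ≠ 0 := by exact_mod_cast hC.ne'
  rw [mulVec_Mmat]
  ext i; fin_cases i <;> simp [Gm] <;> field_simp <;> ring

theorem ctx_of_tile {A B C : ℤ} {T : Set (Fin 3 → ℝ)} (h : IsABCTile A B C T) :
    Ctx A B C T := by
  obtain ⟨hA, hAB, hBC, ne, cpt, -, heq⟩ := h
  have hC : 0 < C := by omega
  refine ⟨hA, hAB, hBC, ne, cpt, ?_, ?_⟩
  · intro x hx d h0 h1
    have : x + dig d ∈ (Mmat A B C).mulVec '' T := by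
      rw [heq]
      simp only [Set.mem_iUnion]
      exact ⟨dig d, ⟨d, h0, h1, rfl⟩, x, hx, rfl⟩
    obtain ⟨y, hy, e⟩ := this
    rw [gm, ← e, Gm_mulVec A B C hC]; exact hy
  · intro y hy
    have : (Mmat A B C).mulVec y ∈ (Mmat A B C).mulVec '' T := ⟨y, hy, rfl⟩
    rw [heq] at this
    simp only [Set.mem_iUnion] at this
    obtain ⟨_, ⟨d, h0, h1, rfl⟩, x, hx, e⟩ := this
    refine ⟨d, h0, h1, x, hx, ?_⟩
    rw [gm]
    change _ = Gm A B C ((fun x => x + ![(d : ℝ), 0, 0]) x)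
    rw [e, Gm_mulVec A B C hC]

theorem Gm_sub (A B C : ℤ) (x y : Fin 3 → ℝ) :
    Gm A B C (x - y) = Gm A B C x - Gm A B C y := by
  ext i; fin_cases i <;> simp [Gm] <;> ring

theorem gm_sub (A B C d : ℤ) (x y : Fin 3 → ℝ) :
    gm A B C d x - gm A B C d y = Gm A B C (x - y) := by
  rw [gm, gm, ← Gm_sub]; congr 1; abel

theorem fm_zero (A B C d : ℤ) (h0 : 0 ≤ d) (h1 : d < C) : fm A B C d 0 = 0 := by
  have : d / C = 0 := Int.ediv_eq_zero_of_lt h0 h1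
  simp [fm, this]

theorem Jr_zero (A B : ℤ) : Jr A B 0 = 0 := by
  ext i; fin_cases i <;> simp [Jr, Jz, toR]

theorem gm_Jr (A B C d : ℤ) (hC : 0 < C) (x : Fin 3 → ℝ) (v : ℤ × ℤ × ℤ) :
    gm A B C d x - Jr A B (fm A B C d v) =
      gm A B C ((v.1 + A * v.2.1 + B * v.2.2 + d) % C) (x - Jr A B v) := by
  have hC' : (C : ℝ) ≠ 0 := by exact_mod_cast hC.ne'
  obtain ⟨p, q, n⟩ := v
  have key := Int.emod_add_mul_ediv (p + A * q + B * n + d) C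
  simp only [fm]
  set r := (p + A * q + B * n + d) % C
  set m := (p + A * q + B * n + d) / C
  have key' : (r : ℝ) = p + A * q + B * n + d - C * m := by
    have : ((r + C * m : ℤ) : ℝ) = ((p + A * q + B * n + d : ℤ) : ℝ) := by rw [key]
    push_cast at this; linarith
  ext i; fin_cases i <;> simp [gm, Gm, Jr, Jz, toR, dig, key'] <;> field_simp <;> ring

variable {A B C : ℤ} {T : Set (Fin 3 → ℝ)}

theorem Ctx.hC (h : Ctx A B C T) : 0 < C := by
  have := h.hA; have := h.hAB; have := h.hBC; omega

theorem Ctx.step (h : Ctx A B C T) {d : ℤ} {x : Fin 3 → ℝ}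
    {v : ℤ × ℤ × ℤ} (hx : x - Jr A B v ∈ T) : gm A B C d x - Jr A B (fm A B C d v) ∈ T := by
  rw [gm_Jr _ _ _ _ h.hC]
  exact h.sub _ hx _ (Int.emod_nonneg _ h.hC.ne') (Int.emod_lt_of_pos _ h.hC)

theorem Ctx.unstep (h : Ctx A B C T) {d : ℤ} {x : Fin 3 → ℝ}
    {w : ℤ × ℤ × ℤ} (hx : gm A B C d x - Jr A B w ∈ T) :
    ∃ v, fm A B C d v = w ∧ x - Jr A B v ∈ T := by
  have hC' : (C : ℝ) ≠ 0 := by exact_mod_cast h.hC.ne'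
  obtain ⟨p, q, n⟩ := w
  obtain ⟨e, h0, h1, t, ht, eq⟩ := h.sup _ hx
  refine ⟨(-A * p - B * q - C * n + e - d, p, q), ?_, ?_⟩
  · have : (-A * p - B * q - C * n + e - d + A * p + B * q + d) / C = -n := by
      rw [show -A * p - B * q - C * n + e - d + A * p + B * q + d = e + C * (-n) by ring,
        Int.add_mul_ediv_left _ _ h.hC.ne', Int.ediv_eq_zero_of_lt h0 h1]; ring
    simp only [fm]
    rw [this, neg_neg]
  · convert ht using 1
    have e0 := congr_fun eq 0
    have e1 := congr_fun eq 1
    have e2 := congr_fun eq 2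
    simp [gm, Gm, Jr, Jz, toR, dig] at e0 e1 e2
    have e3 : (t 0 + e) / (C : ℝ) = (x 0 + d) / C + n := by linarith
    rw [e3] at e0 e1
    have e4 : t 0 + e = x 0 + d + C * n := by
      field_simp at e3; linarith
    ext i; fin_cases i <;> simp [Jr, Jz, toR] <;> linarith

/-- Words. -/
noncomputable def gw (A B C : ℤ) : List ℤ → (Fin 3 → ℝ) → (Fin 3 → ℝ)
  | [], x => x
  | d :: w, x => gm A B C d (gw A B C w x)

def fw (A B C : ℤ) : List ℤ → ℤ × ℤ × ℤ → ℤ × ℤ × ℤ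
  | [], x => x
  | d :: w, x => fm A B C d (fw A B C w x)

def Valid (C : ℤ) (w : List ℤ) : Prop := ∀ d ∈ w, 0 ≤ d ∧ d < C

theorem gw_sub (w : List ℤ) (x y : Fin 3 → ℝ) :
    gw A B C w x - gw A B C w y = (Gm A B C)^[w.length] (x - y) := by
  induction w with
  | nil => simp [gw]
  | cons d w ih => rw [gw, gw, gm_sub, ih, List.length_cons, Function.iterate_succ_apply']

theorem fw_zero (w : List ℤ) (hw : Valid C w) : fw A B C w 0 = 0 := by
  induction w with
  | nil => simp [fw]
  | cons d w ih =>
    have hd := hw d (by simp)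
    rw [fw, ih (fun e he => hw e (by simp [he])), fm_zero _ _ _ _ hd.1 hd.2]

theorem Ctx.stepw (h : Ctx A B C T) (w : List ℤ) {x : Fin 3 → ℝ}
    {v : ℤ × ℤ × ℤ} (hx : x - Jr A B v ∈ T) :
    gw A B C w x - Jr A B (fw A B C w v) ∈ T := by
  induction w with
  | nil => simpa [gw, fw]
  | cons d w ih => exact h.step ih

theorem Ctx.subw (h : Ctx A B C T) (w : List ℤ) (hw : Valid C w) {x : Fin 3 → ℝ}
    (hx : x ∈ T) : gw A B C w x ∈ T := by
  have := h.stepw w (x := x) (v := 0) (by simpa [Jr_zero])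
  simpa [fw_zero w hw, Jr_zero] using this

theorem Ctx.unstepw (h : Ctx A B C T) (w : List ℤ) {x : Fin 3 → ℝ}
    {u : ℤ × ℤ × ℤ} (hx : gw A B C w x - Jr A B u ∈ T) :
    ∃ v, fw A B C w v = u ∧ x - Jr A B v ∈ T := by
  induction w generalizing u with
  | nil => exact ⟨u, rfl, hx⟩
  | cons d w ih =>
    obtain ⟨v, hv, h1⟩ := h.unstep hx
    obtain ⟨v', hv', h2⟩ := ih h1
    exact ⟨v', by rw [fw, hv', hv], h2⟩

theorem Ctx.supw (h : Ctx A B C T) (k : ℕ) {y : Fin 3 → ℝ} (hy : y ∈ T) :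
    ∃ w, Valid C w ∧ w.length = k ∧ ∃ x ∈ T, y = gw A B C w x := by
  induction k generalizing y with
  | zero => exact ⟨[], by simp [Valid], rfl, y, hy, rfl⟩
  | succ k ih =>
    obtain ⟨d, h0, h1, x, hx, rfl⟩ := h.sup y hy
    obtain ⟨w, hw, hl, z, hz, rfl⟩ := ih hx
    refine ⟨d :: w, ?_, by simp [hl], z, hz, rfl⟩
    intro e he
    rcases List.mem_cons.1 he with rfl | he
    · exact ⟨h0, h1⟩
    · exact hw e he

/-- Window coordinates. -/
def Um (A B : ℤ) (a b c d : ℝ) : Fin 3 → ℝ :=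
  ![(b - a) + A * (c - b) + B * (d - c), (c - b) + A * (d - c), d - c]

noncomputable def nx (A B C : ℤ) (a b c d : ℝ) : ℝ :=
  ((C - B) * d + (B - A) * c + (A - 1) * b + a) / C

theorem Gm_Um (hC : 0 < C) (a b c d : ℝ) :
    Gm A B C (Um A B a b c d) = Um A B b c d (nx A B C a b c d) := by
  have hC' : (C : ℝ) ≠ 0 := by exact_mod_cast hC.ne'
  ext i; fin_cases i <;> simp [Gm, Um, nx] <;> field_simp <;> ring

theorem nx_bound (hA : 1 ≤ A) (hAB : A ≤ B) (hBC : B < C) {l h a b c d : ℝ}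
    (ha : a ∈ Set.Icc l h) (hb : b ∈ Set.Icc l h) (hc : c ∈ Set.Icc l h) (_hd : d ∈ Set.Icc l h) :
    nx A B C a b c d ≤ h - ((C - B) / C) * (h - d) ∧
    l + ((C - B) / C) * (d - l) ≤ nx A B C a b c d := by
  have h1 : (1 : ℝ) ≤ A := by exact_mod_cast hA
  have h2 : (A : ℝ) ≤ B := by exact_mod_cast hAB
  have h3 : (B : ℝ) < C := by exact_mod_cast hBC
  have hC : (0 : ℝ) < C := by linarith
  have e1 : h - ((C - B) / C) * (h - d) = (C * h - (C - B) * (h - d)) / C := by field_simp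
  have e2 : l + ((C - B) / C) * (d - l) = (C * l + (C - B) * (d - l)) / C := by field_simp
  rw [e1, e2, nx, div_le_div_iff_of_pos_right hC, div_le_div_iff_of_pos_right hC]
  obtain ⟨ha1, ha2⟩ := ha
  obtain ⟨hb1, hb2⟩ := hb
  obtain ⟨hc1, hc2⟩ := hc
  have m1 := mul_nonneg (sub_nonneg.2 h1) (sub_nonneg.2 hb1)
  have m2 := mul_nonneg (sub_nonneg.2 h1) (sub_nonneg.2 hb2)
  have m3 := mul_nonneg (sub_nonneg.2 h2) (sub_nonneg.2 hc1)
  have m4 := mul_nonneg (sub_nonneg.2 h2) (sub_nonneg.2 hc2)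
  constructor <;> nlinarith

theorem four_step (hA : 1 ≤ A) (hAB : A ≤ B) (hBC : B < C) :
    ∃ ρ : ℝ, 0 ≤ ρ ∧ ρ < 1 ∧ ∀ l h a b c d : ℝ, a ∈ Set.Icc l h → b ∈ Set.Icc l h →
      c ∈ Set.Icc l h → d ∈ Set.Icc l h → ∃ l' h' a' b' c' d' : ℝ, a' ∈ Set.Icc l' h' ∧
      b' ∈ Set.Icc l' h' ∧ c' ∈ Set.Icc l' h' ∧ d' ∈ Set.Icc l' h' ∧ h' - l' = ρ * (h - l) ∧
      (Gm A B C)^[4] (Um A B a b c d) = Um A B a' b' c' d' := by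
  have h1 : (1 : ℝ) ≤ A := by exact_mod_cast hA
  have h2 : (A : ℝ) ≤ B := by exact_mod_cast hAB
  have h3 : (B : ℝ) < C := by exact_mod_cast hBC
  have hC : (0 : ℝ) < C := by linarith
  have hC0 : 0 < C := by omega
  obtain ⟨k, hk⟩ : ∃ k : ℝ, k = (C - B) / C := ⟨_, rfl⟩
  have hk0 : 0 < k := by rw [hk]; exact div_pos (by linarith) hC
  have hk1 : k ≤ 1 := by rw [hk, div_le_one hC]; linarith
  refine ⟨1 - k ^ 4, ?_, ?_, ?_⟩
  · have := pow_le_one₀ (n := 4) hk0.le hk1; linarith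
  · have := pow_pos hk0 4; linarith
  intro l h a b c d ha hb hc hd
  -- one step, with remaining depth
  have one : ∀ a b c d, a ∈ Set.Icc l h → b ∈ Set.Icc l h → c ∈ Set.Icc l h → d ∈ Set.Icc l h →
      nx A B C a b c d ∈ Set.Icc l h ∧ k * (h - d) ≤ h - nx A B C a b c d ∧
      k * (d - l) ≤ nx A B C a b c d - l := by
    intro a b c d ha hb hc hd
    have := nx_bound hA hAB hBC ha hb hc hd
    rw [← hk] at this
    have e1 := mul_nonneg hk0.le (sub_nonneg.2 hd.1)
    have e2 := mul_nonneg hk0.le (sub_nonneg.2 hd.2)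
    refine ⟨⟨by linarith, by linarith⟩, by linarith, by linarith⟩
  obtain ⟨s1, hs1⟩ : ∃ s, s = nx A B C a b c d := ⟨_, rfl⟩
  obtain ⟨s2, hs2⟩ : ∃ s, s = nx A B C b c d s1 := ⟨_, rfl⟩
  obtain ⟨s3, hs3⟩ : ∃ s, s = nx A B C c d s1 s2 := ⟨_, rfl⟩
  obtain ⟨s4, hs4⟩ : ∃ s, s = nx A B C d s1 s2 s3 := ⟨_, rfl⟩
  obtain ⟨i1, u1, l1⟩ := one a b c d ha hb hc hd
  rw [← hs1] at i1 u1 l1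
  obtain ⟨i2, u2, l2⟩ := one b c d s1 hb hc hd i1
  rw [← hs2] at i2 u2 l2
  obtain ⟨i3, u3, l3⟩ := one c d s1 s2 hc hd i1 i2
  rw [← hs3] at i3 u3 l3
  obtain ⟨i4, u4, l4⟩ := one d s1 s2 s3 hd i1 i2 i3
  rw [← hs4] at i4 u4 l4
  have chain : ∀ x0 x1 x2 x3 x4 : ℝ, 0 ≤ x0 → k * x0 ≤ x1 → k * x1 ≤ x2 → k * x2 ≤ x3 →
      k * x3 ≤ x4 → k ^ 4 * x0 ≤ x1 ∧ k ^ 4 * x0 ≤ x2 ∧ k ^ 4 * x0 ≤ x3 ∧ k ^ 4 * x0 ≤ x4 := by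
    intro x0 x1 x2 x3 x4 p0 p1 p2 p3 p4
    have q2 : k ^ 2 * x0 ≤ x2 := by
      have := mul_le_mul_of_nonneg_left p1 hk0.le
      linarith [show k ^ 2 * x0 = k * (k * x0) by ring]
    have q3 : k ^ 3 * x0 ≤ x3 := by
      have := mul_le_mul_of_nonneg_left q2 hk0.le
      linarith [show k ^ 3 * x0 = k * (k ^ 2 * x0) by ring]
    have q4 : k ^ 4 * x0 ≤ x4 := by
      have := mul_le_mul_of_nonneg_left q3 hk0.le
      linarith [show k ^ 4 * x0 = k * (k ^ 3 * x0) by ring]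
    have r : ∀ n : ℕ, n ≤ 4 → k ^ 4 * x0 ≤ k ^ n * x0 := fun n hn =>
      mul_le_mul_of_nonneg_right (pow_le_pow_of_le_one hk0.le hk1 hn) p0
    have r1 := r 1 (by norm_num)
    rw [pow_one] at r1
    exact ⟨r1.trans p1, (r 2 (by norm_num)).trans q2, (r 3 (by norm_num)).trans q3, q4⟩
  obtain ⟨v1, v2, v3, v4⟩ := chain _ _ _ _ _ (sub_nonneg.2 hd.2) u1 u2 u3 u4
  obtain ⟨w1, w2, w3, w4⟩ := chain _ _ _ _ _ (sub_nonneg.2 hd.1) l1 l2 l3 l4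
  refine ⟨l + k ^ 4 * (d - l), h - k ^ 4 * (h - d), s1, s2, s3, s4, ⟨by linarith, by linarith⟩,
    ⟨by linarith, by linarith⟩, ⟨by linarith, by linarith⟩, ⟨by linarith, by linarith⟩, by ring, ?_⟩
  simp only [Function.iterate_succ_apply, Function.iterate_zero, id]
  rw [Gm_Um hC0, ← hs1, Gm_Um hC0, ← hs2, Gm_Um hC0, ← hs3, Gm_Um hC0, ← hs4]

theorem many_step (hA : 1 ≤ A) (hAB : A ≤ B) (hBC : B < C) :
    ∃ ρ : ℝ, 0 ≤ ρ ∧ ρ < 1 ∧ ∀ j : ℕ, ∀ l h a b c d : ℝ, a ∈ Set.Icc l h → b ∈ Set.Icc l h →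
      c ∈ Set.Icc l h → d ∈ Set.Icc l h → ∃ l' h' a' b' c' d' : ℝ, a' ∈ Set.Icc l' h' ∧
      b' ∈ Set.Icc l' h' ∧ c' ∈ Set.Icc l' h' ∧ d' ∈ Set.Icc l' h' ∧ h' - l' = ρ ^ j * (h - l) ∧
      (Gm A B C)^[4 * j] (Um A B a b c d) = Um A B a' b' c' d' := by
  obtain ⟨ρ, h0, h1, H⟩ := four_step hA hAB hBC
  refine ⟨ρ, h0, h1, ?_⟩
  intro j
  induction j with
  | zero =>
    intro l h a b c d ha hb hc hd
    exact ⟨l, h, a, b, c, d, ha, hb, hc, hd, by ring, rfl⟩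
  | succ j ih =>
    intro l h a b c d ha hb hc hd
    obtain ⟨l', h', a', b', c', d', ha', hb', hc', hd', e, E⟩ := ih l h a b c d ha hb hc hd
    obtain ⟨l2, h2, a2, b2, c2, d2, ha2, hb2, hc2, hd2, e2, E2⟩ :=
      H l' h' a' b' c' d' ha' hb' hc' hd'
    refine ⟨l2, h2, a2, b2, c2, d2, ha2, hb2, hc2, hd2, by rw [e2, e]; ring, ?_⟩
    rw [show 4 * (j + 1) = 4 + 4 * j by ring, Function.iterate_add_apply, E, E2]

theorem contract (hA : 1 ≤ A) (hAB : A ≤ B) (hBC : B < C) (R ε : ℝ) (hε : 0 < ε) :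
    ∃ k : ℕ, ∀ y : Fin 3 → ℝ, ‖y‖ ≤ R → ‖(Gm A B C)^[k] y‖ < ε := by
  have h1 : (1 : ℝ) ≤ A := by exact_mod_cast hA
  have h2 : (A : ℝ) ≤ B := by exact_mod_cast hAB
  obtain ⟨ρ, hρ0, hρ1, H⟩ := many_step hA hAB hBC
  obtain ⟨K, hK⟩ : ∃ K : ℝ, K = (1 + A + B) := ⟨_, rfl⟩
  have hK1 : 1 ≤ K := by linarith
  obtain ⟨S, hS⟩ : ∃ S : ℝ, S = 10 * K * K * (|R| + 1) := ⟨_, rfl⟩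
  have hKK : 1 ≤ K * K := by nlinarith
  have hR := abs_nonneg R
  have hSpos : 0 < S := by rw [hS]; positivity
  have hcoef : 0 < K * (2 * S) := by positivity
  obtain ⟨j, hj⟩ := exists_pow_lt_of_lt_one (div_pos hε hcoef) hρ1
  refine ⟨4 * j, ?_⟩
  intro y hy
  have c0 := (norm_le_pi_norm y 0).trans hy
  have c1 := (norm_le_pi_norm y 1).trans hy
  have c2 := (norm_le_pi_norm y 2).trans hy
  have hR0 : 0 ≤ R := (norm_nonneg _).trans hy
  rw [abs_of_nonneg hR0] at hS
  rw [Real.norm_eq_abs, abs_le] at c0 c1 c2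
  obtain ⟨a2, ha2⟩ : ∃ a : ℝ, a = y 2 := ⟨_, rfl⟩
  obtain ⟨a1, ha1⟩ : ∃ a : ℝ, a = y 1 - A * a2 := ⟨_, rfl⟩
  obtain ⟨a0, ha0⟩ : ∃ a : ℝ, a = y 0 - A * a1 - B * a2 := ⟨_, rfl⟩
  have hy' : y = Um A B 0 a0 (a0 + a1) (a0 + a1 + a2) := by
    ext i; fin_cases i <;> simp [Um, ha0, ha1, ha2]; ring
  have b2 : |a2| ≤ R := by rw [ha2, abs_le]; exact c2
  have b1 : |a1| ≤ K * R := by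
    have t : |A * a2| ≤ A * R := by
      rw [abs_mul, abs_of_nonneg (by linarith : (0:ℝ) ≤ A)]
      exact mul_le_mul_of_nonneg_left b2 (by linarith)
    rw [abs_le] at t ⊢
    constructor <;> rw [ha1] <;> nlinarith
  have b0 : |a0| ≤ 2 * K * K * R := by
    have t : |A * a1| ≤ A * (K * R) := by
      rw [abs_mul, abs_of_nonneg (by linarith : (0:ℝ) ≤ A)]
      exact mul_le_mul_of_nonneg_left b1 (by linarith)
    have t2 : |B * a2| ≤ B * R := by
      rw [abs_mul, abs_of_nonneg (by linarith : (0:ℝ) ≤ B)]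
      exact mul_le_mul_of_nonneg_left b2 (by linarith)
    have q1 : A * (K * R) ≤ K * K * R := by
      have : 0 ≤ K * R := by positivity
      nlinarith
    have q2 : R + B * R ≤ K * K * R := by
      have : R + B * R ≤ K * R := by rw [hK]; nlinarith
      have : K * R ≤ K * K * R := by nlinarith [mul_nonneg (by linarith : 0 ≤ K) hR0]
      linarith
    rw [abs_le] at t t2 ⊢
    constructor <;> rw [ha0] <;> linarith
  have hb : R ≤ K * K * R ∧ K * R ≤ K * K * R := by
    constructor <;> nlinarith [mul_nonneg (by linarith : 0 ≤ K) hR0]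
  have hSR : 10 * (K * K * R) ≤ S := by rw [hS]; nlinarith
  have hKKR : 0 ≤ K * K * R := by positivity
  rw [abs_le] at b0 b1 b2
  obtain ⟨hb3, hb4⟩ := hb
  obtain ⟨l, h, a, b, c, d, ha, hb, hc, hd, e, E⟩ := H j (-S) S 0 a0 (a0 + a1) (a0 + a1 + a2)
    ⟨by linarith, by linarith⟩ ⟨by linarith, by linarith⟩ ⟨by linarith, by linarith⟩
    ⟨by linarith, by linarith⟩
  rw [hy', E]
  obtain ⟨D, hD⟩ : ∃ D : ℝ, D = h - l := ⟨_, rfl⟩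
  have hD0 : 0 ≤ D := by rw [hD]; linarith [ha.1, ha.2]
  have hDε : K * D < ε := by
    rw [lt_div_iff₀ hcoef] at hj
    calc K * D = ρ ^ j * (K * (2 * S)) := by rw [hD, e]; ring
      _ < ε := hj
  rw [pi_norm_lt_iff hε]
  have d0 : |b - a| ≤ D := by rw [abs_le, hD]; constructor <;> linarith [ha.1, ha.2, hb.1, hb.2]
  have d1 : |c - b| ≤ D := by rw [abs_le, hD]; constructor <;> linarith [hc.1, hc.2, hb.1, hb.2]
  have d2 : |d - c| ≤ D := by rw [abs_le, hD]; constructor <;> linarith [hc.1, hc.2, hd.1, hd.2]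
  have mA : ∀ z : ℝ, |z| ≤ D → |A * z| ≤ A * D := fun z hz => by
    rw [abs_mul, abs_of_nonneg (by linarith : (0:ℝ) ≤ A)]
    exact mul_le_mul_of_nonneg_left hz (by linarith)
  have mB : ∀ z : ℝ, |z| ≤ D → |B * z| ≤ B * D := fun z hz => by
    rw [abs_mul, abs_of_nonneg (by linarith : (0:ℝ) ≤ B)]
    exact mul_le_mul_of_nonneg_left hz (by linarith)
  have x1 := mA _ d1
  have x2 := mA _ d2
  have x3 := mB _ d2
  have hBD : 0 ≤ B * D := mul_nonneg (by linarith) hD0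
  have hAD : 0 ≤ A * D := mul_nonneg (by linarith) hD0
  have hKD : K * D = D + A * D + B * D := by rw [hK]; ring
  rw [abs_le] at d0 d1 d2 x1 x2 x3
  intro i
  rw [Real.norm_eq_abs, abs_lt]
  fin_cases i <;> simp only [Um, Fin.zero_eta, Fin.mk_one, Fin.reduceFinMk, Matrix.cons_val] <;>
    constructor <;> linarith

def bi (a : Bool) : ℤ := if a then 1 else 0

/-- The lattice code of a binary window. -/
def Vm (a b c d : Bool) : ℤ × ℤ × ℤ := (bi b - bi a, bi c - bi b, bi d - bi c)

def Lm (A B C : ℤ) (a b c d : Bool) : ℤ :=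
  (if d then C - B else 0) + (if c then B - A else 0) + (if b then A - 1 else 0) +
    (if a then 1 else 0)

theorem fm_Vm (hA : 1 ≤ A) (hAB : A ≤ B) (hBC : B < C) {d : ℤ} (h0 : 0 ≤ d) (h1 : d < C)
    (a b c e : Bool) :
    fm A B C d (Vm a b c e) = Vm b c e (decide (d < Lm A B C a b c e)) := by
  have hC : C ≠ 0 := by omega
  have hL : 0 ≤ Lm A B C a b c e ∧ Lm A B C a b c e ≤ C := by
    unfold Lm; constructor <;> split_ifs <;> omega
  have hx : (bi b - bi a) + A * (bi c - bi b) + B * (bi e - bi c) + d =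
      (d - Lm A B C a b c e) + C * bi e := by
    cases a <;> cases b <;> cases c <;> cases e <;> simp [bi, Lm] <;> ring
  simp only [fm, Vm, Prod.mk.injEq, true_and]
  rw [hx, Int.add_mul_ediv_left _ _ hC]
  generalize Lm A B C a b c e = L at *
  by_cases hd : d < L
  · have : (d - L) / C = -1 := by
      rw [Int.ediv_eq_iff_of_pos (by omega)]
      constructor <;> linarith
    simp [this, hd, bi]
    ring
  · have : (d - L) / C = 0 := Int.ediv_eq_zero_of_lt (by omega) (by omega)
    simp [this, hd, bi]

def InW (v : ℤ × ℤ × ℤ) : Prop := ∃ a b c d, v = Vm a b c d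

/-- Existence of a word sending all of `W` to `0` or `β`, and really reaching `β`. -/
def Good (A B C : ℤ) (β : ℤ × ℤ × ℤ) : Prop :=
  ∃ w, Valid C w ∧ (∀ v, InW v → fw A B C w v = 0 ∨ fw A B C w v = β) ∧
    ∃ v, InW v ∧ fw A B C w v = β

theorem Good.step {β : ℤ × ℤ × ℤ} (h : Good A B C β) (d : ℤ) (h0 : 0 ≤ d) (h1 : d < C) :
    Good A B C (fm A B C d β) := by
  obtain ⟨w, hw, h2, v, hv, h3⟩ := h
  refine ⟨d :: w, ?_, ?_, v, hv, by rw [fw, h3]⟩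
  · intro e he
    rcases List.mem_cons.1 he with rfl | he
    · exact ⟨h0, h1⟩
    · exact hw e he
  · intro v hv
    rcases h2 v hv with e | e
    · left; rw [fw, e, fm_zero _ _ _ _ h0 h1]
    · right; rw [fw, e]

theorem step_zero (hA : 1 ≤ A) (hAB : A ≤ B) (hBC : B < C) (a b c e : Bool)
    (h : 0 < Lm A B C a b c e) :
    fm A B C 0 (Vm a b c e) = Vm b c e true := by
  rw [fm_Vm hA hAB hBC le_rfl (by omega)]; simp [h]

theorem step_top (hA : 1 ≤ A) (hAB : A ≤ B) (hBC : B < C) (a b c e : Bool)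
    (h : Lm A B C a b c e < C) :
    fm A B C (C - 1) (Vm a b c e) = Vm b c e false := by
  rw [fm_Vm hA hAB hBC (by omega) (by omega)]
  rw [decide_eq_false (by omega)]

theorem good_base (hA : 1 ≤ A) (hAB : A < B) (hBC : B < C) :
    Good A B C (Vm true false false false) := by
  have hv : ∀ k, Valid C (List.replicate k (C - 1)) := by
    intro k d hd
    rw [List.eq_of_mem_replicate hd]; omega
  by_cases hs : A = 1
  · have st : ∀ a b c e, fm A B C (C - 1) (Vm a b c e) = Vm b c e (a && c && e) := by
      intro a b c e
      rw [fm_Vm hA hAB.le hBC (by omega) (by omega)]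
      congr 1
      cases a <;> cases b <;> cases c <;> cases e <;> simp [Lm, hs] <;> omega
    refine ⟨List.replicate 4 (C - 1), hv 4, ?_, Vm true false true true, ⟨_, _, _, _, rfl⟩, ?_⟩
    · rintro _ ⟨a, b, c, e, rfl⟩
      simp only [List.replicate, fw, st]
      revert a b c e; decide
    · simp only [List.replicate, fw, st]; decide
  · have st : ∀ a b c e, fm A B C (C - 1) (Vm a b c e) = Vm b c e (a && b && c && e) := by
      intro a b c e
      rw [fm_Vm hA hAB.le hBC (by omega) (by omega)]
      congr 1
      cases a <;> cases b <;> cases c <;> cases e <;> simp [Lm] <;> omega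
    refine ⟨List.replicate 3 (C - 1), hv 3, ?_, Vm false false false true, ⟨_, _, _, _, rfl⟩, ?_⟩
    · rintro _ ⟨a, b, c, e, rfl⟩
      simp only [List.replicate, fw, st]
      revert a b c e; decide
    · simp only [List.replicate, fw, st]; decide

theorem Good.zero {a b c e : Bool} (hA : 1 ≤ A) (hAB : A ≤ B) (hBC : B < C)
    (g : Good A B C (Vm a b c e)) (h : 0 < Lm A B C a b c e) : Good A B C (Vm b c e true) := by
  rw [← step_zero hA hAB hBC a b c e h]; exact g.step 0 le_rfl (by omega)

theorem Good.top {a b c e : Bool} (hA : 1 ≤ A) (hAB : A ≤ B) (hBC : B < C)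
    (g : Good A B C (Vm a b c e)) (h : Lm A B C a b c e < C) : Good A B C (Vm b c e false) := by
  rw [← step_top hA hAB hBC a b c e h]; exact g.step (C - 1) (by omega) (by omega)

theorem good_lone (hA : 1 ≤ A) (hAB : A < B) (hBC : B < C) :
    ∃ w, Valid C w ∧ ∀ v, InW v → fw A B C w v = 0 := by
  have g := (good_base hA hAB hBC).top hA hAB.le hBC (by simp [Lm]; omega)
  obtain ⟨w, hw, h, -⟩ := g
  refine ⟨w, hw, fun v hv => ?_⟩
  rcases h v hv with e | e
  · exact e
  · rw [e]; decide

theorem good_all (hA : 1 ≤ A) (hAB : A < B) (hBC : B < C) (v : ℤ × ℤ × ℤ) (hv : InW v)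
    (h0 : v ≠ 0) : Good A B C v := by
  have g1000 := good_base hA hAB hBC
  have g0001 := g1000.zero hA hAB.le hBC (by simp [Lm])
  have g0010 := g0001.top hA hAB.le hBC (by simp [Lm]; omega)
  have g0011 := g0001.zero hA hAB.le hBC (by simp [Lm]; omega)
  have g0100 := g0010.top hA hAB.le hBC (by simp [Lm]; omega)
  have g0101 := g0010.zero hA hAB.le hBC (by simp [Lm]; omega)
  have g0111 := g0011.zero hA hAB.le hBC (by simp [Lm]; omega)
  have g0110 := g0011.top hA hAB.le hBC (by simp [Lm]; omega)
  have g1100 := g0110.top hA hAB.le hBC (by simp [Lm]; omega)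
  have g1001 := g1100.zero hA hAB.le hBC (by simp [Lm]; omega)
  have g1110 := g0111.top hA hAB.le hBC (by simp [Lm])
  have g1101 := g1110.zero hA hAB.le hBC (by simp [Lm]; omega)
  have g1011 := g0101.zero hA hAB.le hBC (by simp [Lm]; omega)
  have g1010 := g0101.top hA hAB.le hBC (by simp [Lm]; omega)
  obtain ⟨a, b, c, e, rfl⟩ := hv
  cases a <;> cases b <;> cases c <;> cases e <;> first | assumption | exact absurd (by decide) h0

/-- Every element of `W` has a predecessor in `W`. -/
theorem pred_W (hA : 1 ≤ A) (hAB : A ≤ B) (hBC : B < C) (v : ℤ × ℤ × ℤ) (hv : InW v) :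
    ∃ u, InW u ∧ ∃ d, 0 ≤ d ∧ d < C ∧ fm A B C d u = v := by
  have z : ∀ a b c e, 0 < Lm A B C a b c e →
      ∃ u, InW u ∧ ∃ d, 0 ≤ d ∧ d < C ∧ fm A B C d u = Vm b c e true :=
    fun a b c e h => ⟨_, ⟨a, b, c, e, rfl⟩, 0, le_rfl, by omega, step_zero hA hAB hBC a b c e h⟩
  have t : ∀ a b c e, Lm A B C a b c e < C →
      ∃ u, InW u ∧ ∃ d, 0 ≤ d ∧ d < C ∧ fm A B C d u = Vm b c e false :=
    fun a b c e h => ⟨_, ⟨a, b, c, e, rfl⟩, C - 1, by omega, by omega,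
      step_top hA hAB hBC a b c e h⟩
  obtain ⟨a, b, c, e, rfl⟩ := hv
  cases e
  · exact t false a b c (by cases a <;> cases b <;> cases c <;> simp [Lm] <;> omega)
  · exact z true a b c (by cases a <;> cases b <;> cases c <;> simp [Lm] <;> omega)

def Nb (A B : ℤ) (T : Set (Fin 3 → ℝ)) (v : ℤ × ℤ × ℤ) : Prop := ∃ x ∈ T, x - Jr A B v ∈ T

theorem Ctx.bdd (h : Ctx A B C T) : ∃ R : ℝ, ∀ x ∈ T, ∀ y ∈ T, ‖x - y‖ ≤ R := by
  obtain ⟨R, hR⟩ := h.cpt.isBounded.exists_norm_le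
  exact ⟨R + R, fun x hx y hy => (norm_sub_le _ _).trans (add_le_add (hR x hx) (hR y hy))⟩

open Pointwise in
theorem Ctx.nb_of_pred (h : Ctx A B C T) (K : Set (ℤ × ℤ × ℤ)) (hK : K.Finite)
    (hp : ∀ v ∈ K, ∃ u ∈ K, ∃ d, 0 ≤ d ∧ d < C ∧ fm A B C d u = v) :
    ∀ v ∈ K, Nb A B T v := by
  have hw : ∀ k : ℕ, ∀ v ∈ K, ∃ w, Valid C w ∧ w.length = k ∧ ∃ u ∈ K, fw A B C w u = v := by
    intro k
    induction k with
    | zero => intro v hv; exact ⟨[], by simp [Valid], rfl, v, hv, rfl⟩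
    | succ k ih =>
      intro v hv
      obtain ⟨u, hu, d, h0, h1, e⟩ := hp v hv
      obtain ⟨w, hw, hl, u', hu', e'⟩ := ih u hu
      refine ⟨d :: w, ?_, by simp [hl], u', hu', by rw [fw, e', e]⟩
      intro e he
      rcases List.mem_cons.1 he with rfl | he
      · exact ⟨h0, h1⟩
      · exact hw e he
  intro v hv
  have hcl : IsClosed (T - T) := by
    rw [sub_eq_add_neg]; exact (h.cpt.add h.cpt.neg).isClosed
  obtain ⟨R, hR⟩ := (hK.image (Jr A B)).isBounded.exists_norm_le
  obtain ⟨t, ht⟩ := h.ne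
  have hmem : Jr A B v ∈ closure (T - T) := by
    rw [Metric.mem_closure_iff]
    intro ε hε
    obtain ⟨k, hk⟩ := contract h.hA h.hAB h.hBC R ε hε
    obtain ⟨w, hw, hl, u, hu, e⟩ := hw k v hv
    have m1 := h.subw w hw ht
    have m2 := h.stepw w (x := t + Jr A B u) (v := u) (by simpa using ht)
    rw [e] at m2
    refine ⟨_, Set.sub_mem_sub m1 m2, ?_⟩
    have := gw_sub (A := A) (B := B) (C := C) w (t + Jr A B u) t
    rw [hl, add_sub_cancel_left] at this
    have b := hk _ (hR _ ⟨u, hu, rfl⟩)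
    rw [← this] at b
    rw [dist_eq_norm, show Jr A B v - (gw A B C w t - (gw A B C w (t + Jr A B u) - Jr A B v)) =
      gw A B C w (t + Jr A B u) - gw A B C w t by abel]
    exact b
  rw [hcl.closure_eq] at hmem
  obtain ⟨x, hx, y, hy, e⟩ := hmem
  refine ⟨x, hx, ?_⟩
  rw [← e]; simpa using hy

theorem Jz_inj (A B : ℤ) : Function.Injective (Jz A B) := by
  rintro ⟨p, q, n⟩ ⟨p', q', n'⟩ h
  have e0 := congr_fun h 0
  have e1 := congr_fun h 1
  have e2 := congr_fun h 2
  simp [Jz] at e0 e1 e2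
  subst e2
  have e1 : q = q' := by linarith
  subst e1
  have e0 : p = p' := by linarith
  subst e0
  rfl

theorem Jz_surj (A B : ℤ) : Function.Surjective (Jz A B) := by
  intro α
  refine ⟨(α 0 - A * (α 1 - A * α 2) - B * α 2, α 1 - A * α 2, α 2), ?_⟩
  ext i; fin_cases i <;> simp [Jz]; ring

theorem Jz_zero (A B : ℤ) : Jz A B 0 = 0 := by
  ext i; fin_cases i <;> simp [Jz]

theorem Jr_neg (A B : ℤ) (v : ℤ × ℤ × ℤ) : Jr A B (-v) = -Jr A B v := by
  ext i; fin_cases i <;> simp [Jr, Jz, toR] <;> ring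

theorem mem_tt (v x : Fin 3 → ℝ) : x ∈ tileTranslate v T ↔ x - v ∈ T := by
  constructor
  · rintro ⟨y, hy, rfl⟩; simpa using hy
  · intro hx; exact ⟨_, hx, by simp⟩

theorem neighbors_eq : Neighbors T = Jz A B '' {v | v ≠ 0 ∧ Nb A B T v} := by
  ext α
  obtain ⟨v, rfl⟩ := Jz_surj A B α
  rw [(Jz_inj A B).mem_set_image]
  simp only [Neighbors, Set.mem_ofPred_eq]
  refine and_congr ?_ ?_
  · rw [← Jz_zero A B, (Jz_inj A B).ne_iff]
  · constructor
    · rintro ⟨x, hx, hx'⟩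
      exact ⟨x, hx, (mem_tt _ _).1 hx'⟩
    · rintro ⟨x, hx, hx'⟩
      exact ⟨x, hx, (mem_tt _ _).2 hx'⟩

def Wfin : Finset (ℤ × ℤ × ℤ) :=
  (Finset.univ : Finset (Bool × Bool × Bool × Bool)).image
    fun b => Vm b.1 b.2.1 b.2.2.1 b.2.2.2

theorem mem_Wfin (v : ℤ × ℤ × ℤ) : v ∈ Wfin ↔ InW v := by
  simp only [Wfin, Finset.mem_image, Finset.mem_univ, true_and, InW, Prod.exists, eq_comm]

theorem card_Wfin : (Wfin.erase 0).card = 14 := by decide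

theorem Ctx.nb_W (h : Ctx A B C T) (v : ℤ × ℤ × ℤ) (hv : InW v) : Nb A B T v := by
  refine h.nb_of_pred (Wfin : Set (ℤ × ℤ × ℤ)) Wfin.finite_toSet ?_ v
    (Finset.mem_coe.2 ((mem_Wfin v).2 hv))
  intro v hv
  obtain ⟨u, hu, hd⟩ := pred_W h.hA h.hAB h.hBC v ((mem_Wfin v).1 (Finset.mem_coe.1 hv))
  exact ⟨u, Finset.mem_coe.2 ((mem_Wfin u).2 hu), hd⟩

theorem Ctx.nb_iff (h : Ctx A B C T) (h14 : (Neighbors T).ncard = 14) (v : ℤ × ℤ × ℤ) :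
    Nb A B T v ↔ InW v := by
  refine ⟨fun hv => ?_, h.nb_W v⟩
  by_cases h0 : v = 0
  · subst h0; exact ⟨false, false, false, false, by decide⟩
  rw [neighbors_eq (A := A) (B := B), Set.ncard_image_of_injective _ (Jz_inj A B)] at h14
  have hfin : {v | v ≠ 0 ∧ Nb A B T v}.Finite :=
    Set.finite_of_ncard_ne_zero (by rw [h14]; norm_num)
  have hsub : ((Wfin.erase 0 : Finset _) : Set (ℤ × ℤ × ℤ)) ⊆ {v | v ≠ 0 ∧ Nb A B T v} := by
    intro u hu
    rw [Finset.mem_coe, Finset.mem_erase, mem_Wfin] at hu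
    exact ⟨hu.1, h.nb_W u hu.2⟩
  have := Set.eq_of_subset_of_ncard_le hsub
    (by rw [h14, Set.ncard_coe_finset, card_Wfin]) hfin
  have hv' : v ∈ {v | v ≠ 0 ∧ Nb A B T v} := ⟨h0, hv⟩
  rw [← this, Finset.mem_coe, Finset.mem_erase, mem_Wfin] at hv'
  exact hv'.2

theorem Ctx.lt (h : Ctx A B C T) (h14 : (Neighbors T).ncard = 14) : A < B := by
  by_contra hlt
  have hA := h.hA
  have hBC := h.hBC
  have hAB : A = B := le_antisymm h.hAB (by omega)
  subst hAB
  have hC := h.hC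
  have e1 : fm A A C 0 (-1, -1, 1) = (-1, 1, 1) := by
    have : (-1 + A * -1 + A * 1 + 0) / C = -1 := by
      rw [Int.ediv_eq_iff_of_pos hC]; constructor <;> linarith
    simp only [fm]; rw [this]; rfl
  obtain ⟨d, hd0, hd1, hd2, hd3⟩ : ∃ d, 0 ≤ d ∧ d < C ∧ C ≤ 2 * A - 1 + d ∧ 2 * A - 1 + d < 2 * C := by
    by_cases hc : C ≤ 2 * A - 1
    · exact ⟨0, by omega, by omega, by omega, by omega⟩
    · exact ⟨C - 2 * A + 1, by omega, by omega, by omega, by omega⟩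
  have e2 : fm A A C d (-1, 1, 1) = (1, 1, -1) := by
    have : (-1 + A * 1 + A * 1 + d) / C = 1 := by
      rw [Int.ediv_eq_iff_of_pos hC]; constructor <;> linarith
    simp only [fm]; rw [this]
  have e3 : fm A A C (C - 1) (1, 1, -1) = (1, -1, -1) := by
    have : (1 + A * 1 + A * -1 + (C - 1)) / C = 1 := by
      rw [Int.ediv_eq_iff_of_pos hC]; constructor <;> linarith
    simp only [fm]; rw [this]
  have e4 : fm A A C (C - 1 - d) (1, -1, -1) = (-1, -1, 1) := by
    have : (1 + A * -1 + A * -1 + (C - 1 - d)) / C = -1 := by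
      rw [Int.ediv_eq_iff_of_pos hC]; constructor <;> linarith
    simp only [fm]; rw [this]; rfl
  have := h.nb_of_pred {(-1, -1, 1), (-1, 1, 1), (1, 1, -1), (1, -1, -1)} (by simp) (by
    rintro v (rfl | rfl | rfl | rfl)
    · exact ⟨_, by simp, _, by omega, by omega, e4⟩
    · exact ⟨_, by simp, _, by omega, by omega, e1⟩
    · exact ⟨_, by simp, _, by omega, by omega, e2⟩
    · exact ⟨_, by simp, _, by omega, by omega, e3⟩) (-1, -1, 1) (by simp)
  rw [h.nb_iff h14, ← mem_Wfin] at this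
  revert this
  decide

theorem isClosedEmbedding_toR : Topology.IsClosedEmbedding toR :=
  Topology.IsClosedEmbedding.piMap (fun _ : Fin 3 => Int.isClosedEmbedding_coe_real)

open Pointwise in
theorem Ctx.closedU (h : Ctx A B C T) (P : Set (ℤ × ℤ × ℤ)) :
    IsClosed {x | ∃ v ∈ P, x - Jr A B v ∈ T} := by
  have h1 : IsClosed (toR '' (Jz A B '' P)) :=
    isClosedEmbedding_toR.isClosedMap _ (isClosed_discrete _)
  have h2 := h1.add_left_of_isCompact h.cpt
  convert h2 using 1
  ext x
  constructor
  · rintro ⟨v, hv, hx⟩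
    exact ⟨_, hx, _, ⟨_, ⟨v, hv, rfl⟩, rfl⟩, by simp [Jr]⟩
  · rintro ⟨t, ht, _, ⟨_, ⟨v, hv, rfl⟩, rfl⟩, rfl⟩
    exact ⟨v, hv, by simpa [Jr] using ht⟩

theorem gw_replicate (k : ℕ) (x : Fin 3 → ℝ) :
    gw A B C (List.replicate k 0) x = (Gm A B C)^[k] x := by
  have hd : dig 0 = 0 := by ext i; fin_cases i <;> simp [dig]
  induction k with
  | zero => rfl
  | succ k ih => rw [List.replicate_succ, gw, ih, gm, hd, add_zero, Function.iterate_succ_apply']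

theorem Ctx.cover (h : Ctx A B C T) (x : Fin 3 → ℝ) : ∃ v, x - Jr A B v ∈ T := by
  have hcl := h.closedU Set.univ
  obtain ⟨t, ht⟩ := h.ne
  have hmem : x ∈ closure {x | ∃ v ∈ Set.univ, x - Jr A B v ∈ T} := by
    rw [Metric.mem_closure_iff]
    intro ε hε
    obtain ⟨k, hk⟩ := contract h.hA h.hAB h.hBC 1 ε hε
    have hz : (Gm A B C)^[k] ((Mmat A B C).mulVec^[k] x) = x :=
      Function.LeftInverse.iterate (Gm_mulVec A B C h.hC) k x
    set z := (Mmat A B C).mulVec^[k] x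
    obtain ⟨v, hv⟩ := Jz_surj A B (fun i => ⌊z i - t i⌋)
    have hn : ‖z - (t + Jr A B v)‖ ≤ 1 := by
      rw [pi_norm_le_iff_of_nonneg zero_le_one]
      intro i
      have : (z - (t + Jr A B v)) i = Int.fract (z i - t i) := by
        simp only [Pi.sub_apply, Pi.add_apply, Jr, hv, toR, Int.fract]; ring
      rw [this, Real.norm_eq_abs, abs_of_nonneg (Int.fract_nonneg _)]
      exact (Int.fract_lt_one _).le
    have hs := h.stepw (List.replicate k 0) (x := t + Jr A B v) (v := v) (by simpa using ht)
    refine ⟨_, ⟨_, trivial, hs⟩, ?_⟩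
    have b := hk _ hn
    have e := gw_sub (A := A) (B := B) (C := C) (List.replicate k 0) z (t + Jr A B v)
    rw [List.length_replicate] at e
    rw [← e, gw_replicate, hz] at b
    rwa [dist_eq_norm]
  rw [hcl.closure_eq] at hmem
  obtain ⟨v, -, hv⟩ := hmem
  exact ⟨v, hv⟩

theorem Ctx.lone_dense (h : Ctx A B C T) (h14 : (Neighbors T).ncard = 14) {x : Fin 3 → ℝ}
    (hx : x ∈ T) {ε : ℝ} (hε : 0 < ε) :
    ∃ y ∈ T, dist y x < ε ∧ ∀ u, y - Jr A B u ∈ T → u = 0 := by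
  obtain ⟨R, hR⟩ := h.bdd
  obtain ⟨t, ht⟩ := h.ne
  obtain ⟨k, hk⟩ := contract h.hA h.hAB h.hBC R ε hε
  obtain ⟨w, hw, hl, x', hx', rfl⟩ := h.supw k hx
  obtain ⟨w0, hw0, H⟩ := good_lone h.hA (h.lt h14) h.hBC
  have hy0 := h.subw w0 hw0 ht
  refine ⟨gw A B C w (gw A B C w0 t), h.subw w hw hy0, ?_, ?_⟩
  · rw [dist_eq_norm, gw_sub, hl]
    exact hk _ (hR _ hy0 _ hx')
  · intro u hu
    obtain ⟨v, rfl, hv⟩ := h.unstepw w hu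
    obtain ⟨v', rfl, hv'⟩ := h.unstepw w0 hv
    rw [H v' ((h.nb_iff h14 v').1 ⟨t, ht, hv'⟩), fw_zero w hw]

theorem Ctx.exact (h : Ctx A B C T) (h14 : (Neighbors T).ncard = 14) {α : ℤ × ℤ × ℤ}
    (hα : Nb A B T α) (h0 : α ≠ 0) :
    ∃ y ∈ T, y - Jr A B α ∈ T ∧ ∀ u, y - Jr A B u ∈ T → u = 0 ∨ u = α := by
  obtain ⟨w, hw, H, v, hv, e⟩ :=
    good_all h.hA (h.lt h14) h.hBC α ((h.nb_iff h14 α).1 hα) h0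
  obtain ⟨x, hx, hxv⟩ := h.nb_W v hv
  refine ⟨gw A B C w x, h.subw w hw hx, ?_, ?_⟩
  · have := h.stepw w hxv
    rwa [e] at this
  · intro u hu
    obtain ⟨v', rfl, hv'⟩ := h.unstepw w hu
    exact H v' ((h.nb_iff h14 v').1 ⟨x, hx, hv'⟩)

theorem Ctx.exact_dense (h : Ctx A B C T) (h14 : (Neighbors T).ncard = 14) {α : ℤ × ℤ × ℤ}
    (h0 : α ≠ 0) {x : Fin 3 → ℝ} (hx : x ∈ T) (hxα : x - Jr A B α ∈ T) {ε : ℝ} (hε : 0 < ε) :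
    ∃ y ∈ T, dist y x < ε ∧ y - Jr A B α ∈ T ∧ ∀ u, y - Jr A B u ∈ T → u = 0 ∨ u = α := by
  obtain ⟨R, hR⟩ := h.bdd
  obtain ⟨k, hk⟩ := contract h.hA h.hAB h.hBC R ε hε
  obtain ⟨w, hw, hl, x', hx', rfl⟩ := h.supw k hx
  obtain ⟨v, rfl, hv⟩ := h.unstepw w hxα
  have hv0 : v ≠ 0 := by rintro rfl; exact h0 (fw_zero w hw)
  obtain ⟨y, hy, hyv, hyu⟩ := h.exact h14 ⟨x', hx', hv⟩ hv0
  refine ⟨gw A B C w y, h.subw w hw hy, ?_, h.stepw w hyv, ?_⟩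
  · rw [dist_eq_norm, gw_sub, hl]
    exact hk _ (hR _ hy _ hx')
  · intro u hu
    obtain ⟨v', rfl, hv'⟩ := h.unstepw w hu
    rcases hyu v' hv' with rfl | rfl
    · left; exact fw_zero w hw
    · right; rfl

theorem Ctx.not_interior (h : Ctx A B C T) (h14 : (Neighbors T).ncard = 14) {α : ℤ × ℤ × ℤ}
    (h0 : α ≠ 0) {y : Fin 3 → ℝ} (hy : y - Jr A B α ∈ T) : y ∉ interior T := by
  intro hi
  rw [mem_interior_iff_mem_nhds, Metric.mem_nhds_iff] at hi
  obtain ⟨r, hr, hb⟩ := hi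
  obtain ⟨z, hz, hd, hu⟩ := h.lone_dense h14 hy hr
  have : z + Jr A B α ∈ T := by
    apply hb
    rw [Metric.mem_ball, dist_eq_norm]
    rw [dist_eq_norm] at hd
    convert hd using 2
    abel
  have e := hu (-α) (by rwa [Jr_neg, sub_neg_eq_add])
  exact h0 (neg_eq_zero.1 e)

theorem stmt17 (A B C : ℤ) (T : Set (Fin 3 → ℝ)) (hT : IsABCTile A B C T)
    (h14 : (Neighbors T).ncard = 14) (α : Fin 3 → ℤ) (hα : α ∈ Neighbors T) :
    closure (interior ((Subtype.val ⁻¹' (T ∩ tileTranslate (toR α) T)) :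
        Set (frontier T))) =
      (Subtype.val ⁻¹' (T ∩ tileTranslate (toR α) T) : Set (frontier T)) := by
  have h := ctx_of_tile hT
  obtain ⟨a, rfl⟩ := Jz_surj A B α
  have ha0 : a ≠ 0 := by
    rintro rfl
    exact hα.1 (Jz_zero A B)
  have hset : ∀ x, x ∈ T ∩ tileTranslate (toR (Jz A B a)) T ↔ x ∈ T ∧ x - Jr A B a ∈ T :=
    fun x => and_congr_right fun _ => mem_tt _ _
  have hTcl : IsClosed T := h.cpt.isClosed
  apply Set.Subset.antisymm
  · refine closure_minimal interior_subset (IsClosed.preimage continuous_subtype_val ?_)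
    refine hTcl.inter ?_
    have : tileTranslate (toR (Jz A B a)) T = (fun x => x - toR (Jz A B a)) ⁻¹' T := by
      ext x; exact mem_tt _ _
    rw [this]
    exact hTcl.preimage (by fun_prop)
  · rintro ⟨x, hxF⟩ hx
    have hx' := (hset x).1 hx
    rw [Metric.mem_closure_iff]
    intro ε hε
    obtain ⟨y, hy, hd, hya, hyu⟩ := h.exact_dense h14 ha0 hx'.1 hx'.2 hε
    have hyF : y ∈ frontier T := by
      rw [hTcl.frontier_eq]
      exact ⟨hy, h.not_interior h14 ha0 hya⟩
    refine ⟨⟨y, hyF⟩, ?_, by rw [dist_comm]; exact hd⟩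
    have hO := ((h.closedU {v | v ≠ 0 ∧ v ≠ a}).isOpen_compl).preimage
      (continuous_subtype_val (p := fun x => x ∈ frontier T))
    rw [mem_interior]
    refine ⟨_, ?_, hO, ?_⟩
    · rintro ⟨z, hzF⟩ hz
      refine (hset z).2 ⟨hTcl.frontier_subset hzF, ?_⟩
      have hzc : z ∈ closure Tᶜ := by
        rw [frontier_eq_closure_inter_closure] at hzF; exact hzF.2
      have hz2 : z ∈ {x | ∃ v ∈ {v : ℤ × ℤ × ℤ | v ≠ 0}, x - Jr A B v ∈ T} := by
        refine closure_minimal ?_ (h.closedU _) hzc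
        intro p hp
        obtain ⟨v, hv⟩ := h.cover p
        refine ⟨v, ?_, hv⟩
        rintro rfl
        rw [Jr_zero, sub_zero] at hv
        exact hp hv
      obtain ⟨v, hv0, hv⟩ := hz2
      by_cases hva : v = a
      · rwa [hva] at hv
      · exact absurd ⟨v, ⟨hv0, hva⟩, hv⟩ hz
    · rintro ⟨v, ⟨hv0, hva⟩, hv⟩
      rcases hyu v hv with e | e
      · exact hv0 e
      · exact hva e
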